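/- Let c > 1 be an odd integer and let a be any integer. Then the ranks of odd-balanced unimodal sequences are asymptotically equidistributed modulo c: as n → ∞, v(a,c;n) ~ v(n)/c, i.e. c·v(a,c;n)/v(n) → 1. -/

import Mathlib

open Complex Real Filter Topology

noncomputable section

/-- An odd-balanced unimodal sequence, encoded as (left list `L`, peak `p`, right list `R`):
all parts positive, the peak `p` is even and strictly larger than all other parts,
the left side is weakly increasing and the right side weakly decreasing, repeated
(i.e. equal consecutive) parts are allowed only when they are odd, and the odd parts
before the peak are identical to the odd parts after the peak. -/
def IsOddBalanced (L : List ℕ) (p : ℕ) (R : List ℕ) : Prop :=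
  Even p ∧ 0 < p ∧ (∀ x ∈ L, 0 < x) ∧ (∀ x ∈ R, 0 < x) ∧
  L.Chain' (fun a b => a ≤ b ∧ (a = b → Odd a)) ∧
  R.Chain' (fun a b => b ≤ a ∧ (a = b → Odd a)) ∧
  (∀ x ∈ L, x < p) ∧ (∀ x ∈ R, x < p) ∧
  L.filter (fun x => x % 2 == 1) = R.reverse.filter (fun x => x % 2 == 1)

/-- `v(m,n)`: number of odd-balanced unimodal sequences of size `2n+2` and rank `m`. -/
def oddBalancedCount (m : ℤ) (n : ℕ) : ℕ :=
  Nat.card {x : List ℕ × ℕ × List ℕ //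
    IsOddBalanced x.1 x.2.1 x.2.2 ∧ x.1.sum + x.2.1 + x.2.2.sum = 2 * n + 2 ∧
    (x.2.2.length : ℤ) - (x.1.length : ℤ) = m}

/-- `v(a,c;n)`: number of odd-balanced unimodal sequences of size `2n+2`
whose rank is congruent to `a` modulo `c`. -/
def oddBalancedCountMod (a : ℤ) (c : ℕ) (n : ℕ) : ℕ :=
  Nat.card {x : List ℕ × ℕ × List ℕ //
    IsOddBalanced x.1 x.2.1 x.2.2 ∧ x.1.sum + x.2.1 + x.2.2.sum = 2 * n + 2 ∧
    (x.2.2.length : ℤ) - (x.1.length : ℤ) ≡ a [ZMOD (c : ℤ)]}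

/-- `v(n)`: total number of odd-balanced unimodal sequences of size `2n+2`. -/
def oddBalancedTotal (n : ℕ) : ℕ :=
  Nat.card {x : List ℕ × ℕ × List ℕ //
    IsOddBalanced x.1 x.2.1 x.2.2 ∧ x.1.sum + x.2.1 + x.2.2.sum = 2 * n + 2}

/-- Overpartition function `p̄(n)`: each partition of `n` is counted with
multiplicity `2^(number of distinct parts)` (the overlined parts), which matches the
generating function `∏ (1+qⁿ)/(1-qⁿ)`. -/
def overpartition (n : ℕ) : ℕ := ∑ p : n.Partition, 2 ^ p.parts.toFinset.card

/-! ### Cores: odd-balanced sequences with the parts equal to `1` removed, halved -/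

@[ext] structure OBCore where
  k : ℕ
  A : Finset ℕ
  B : Finset ℕ
  P : Multiset ℕ

namespace OBCore

def Valid (x : OBCore) : Prop :=
  0 < x.k ∧ (∀ a ∈ x.A, 0 < a ∧ a < x.k) ∧ (∀ a ∈ x.B, 0 < a ∧ a < x.k) ∧
    ∀ p ∈ x.P, p % 2 = 1 ∧ 3 ≤ p ∧ p < 2 * x.k

def size (x : OBCore) : ℕ := x.k + ∑ a ∈ x.A, a + ∑ a ∈ x.B, a + x.P.sum

def rk (x : OBCore) : ℤ := (x.B.card : ℤ) - (x.A.card : ℤ)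

lemma k_le_size (x : OBCore) : x.k ≤ x.size := by unfold size; omega

lemma A_le_size (x : OBCore) {a : ℕ} (h : a ∈ x.A) : a ≤ x.size := by
  have := Finset.single_le_sum (f := fun a : ℕ => a) (fun i _ => Nat.zero_le i) h
  unfold size; omega

lemma B_le_size (x : OBCore) {a : ℕ} (h : a ∈ x.B) : a ≤ x.size := by
  have := Finset.single_le_sum (f := fun a : ℕ => a) (fun i _ => Nat.zero_le i) h
  unfold size; omega

lemma P_le_size (x : OBCore) {a : ℕ} (h : a ∈ x.P) : a ≤ x.size := by
  have := Multiset.single_le_sum (fun i _ => Nat.zero_le i) a h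
  unfold size; omega

lemma count_mul_le (s : Multiset ℕ) (a : ℕ) : s.count a * a ≤ s.sum := by
  have h : Multiset.replicate (s.count a) a ≤ s := Multiset.le_count_iff_replicate_le.1 le_rfl
  obtain ⟨u, hu⟩ := Multiset.le_iff_exists_add.1 h
  have := congrArg Multiset.sum hu
  rw [Multiset.sum_add, Multiset.sum_replicate, smul_eq_mul] at this
  omega

lemma count_le_size (x : OBCore) (hx : x.Valid) (a : ℕ) : x.P.count a ≤ x.size := by
  by_cases h : a ∈ x.P
  · have h1 := count_mul_le x.P a
    have h2 := (hx.2.2.2 a h).2.1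
    have h3 : x.P.count a ≤ x.P.count a * a := Nat.le_mul_of_pos_right _ (by omega)
    unfold size
    omega
  · rw [Multiset.count_eq_zero_of_notMem h]; omega

/-- graph of the multiplicity function -/
def gr (P : Multiset ℕ) : Finset (ℕ × ℕ) := P.toFinset.image fun a => (a, P.count a)

lemma gr_inj {P Q : Multiset ℕ} (h : gr P = gr Q) : P = Q := by
  ext a
  by_cases ha : a ∈ P
  · have : (a, P.count a) ∈ gr Q := by
      rw [← h]; exact Finset.mem_image.2 ⟨a, by simpa using ha, rfl⟩
    obtain ⟨b, hb, hb2⟩ := Finset.mem_image.1 this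
    simp only [Prod.mk.injEq] at hb2
    obtain ⟨rfl, h3⟩ := hb2
    exact h3.symm
  · by_cases hb : a ∈ Q
    · have : (a, Q.count a) ∈ gr P := by
        rw [h]; exact Finset.mem_image.2 ⟨a, by simpa using hb, rfl⟩
      obtain ⟨b, hb, hb2⟩ := Finset.mem_image.1 this
      simp only [Prod.mk.injEq] at hb2
      obtain ⟨rfl, h3⟩ := hb2
      exact h3
    · rw [Multiset.count_eq_zero_of_notMem ha, Multiset.count_eq_zero_of_notMem hb]

lemma gr_card (P : Multiset ℕ) : (gr P).card = P.toFinset.card := by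
  apply Finset.card_image_of_injective
  intro a b h
  exact (Prod.mk.inj h).1

/-- code of a core -/
def code (x : OBCore) : ℕ × Finset ℕ × Finset ℕ × Finset (ℕ × ℕ) := (x.k, x.A, x.B, gr x.P)

lemma code_inj : Function.Injective code := by
  intro x y h
  simp only [code, Prod.mk.injEq] at h
  exact OBCore.ext h.1 h.2.1 h.2.2.1 (gr_inj h.2.2.2)

lemma code_mem (x : OBCore) (hx : x.Valid) {N : ℕ} (hN : x.size ≤ N) :
    x.k ∈ Finset.range (N+1) ∧ x.A ∈ (Finset.range (N+1)).powerset ∧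
    x.B ∈ (Finset.range (N+1)).powerset ∧
    gr x.P ∈ (Finset.range (N+1) ×ˢ Finset.range (N+1)).powerset := by
  refine ⟨?_, ?_, ?_, ?_⟩
  · have := x.k_le_size; simp; omega
  · rw [Finset.mem_powerset]; intro a ha; have := x.A_le_size ha; simp; omega
  · rw [Finset.mem_powerset]; intro a ha; have := x.B_le_size ha; simp; omega
  · rw [Finset.mem_powerset]; intro a ha
    obtain ⟨b, hb, rfl⟩ := Finset.mem_image.1 ha
    have h1 := x.P_le_size (Multiset.mem_toFinset.1 hb)
    have h2 := x.count_le_size hx b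
    simp; omega

lemma finite (N : ℕ) : {x : OBCore | x.Valid ∧ x.size ≤ N}.Finite := by
  apply Set.Finite.of_finite_image (f := code) _ (code_inj.injOn)
  apply Set.Finite.subset (Finset.finite_toSet (Finset.range (N+1) ×ˢ (Finset.range (N+1)).powerset ×ˢ
    (Finset.range (N+1)).powerset ×ˢ (Finset.range (N+1) ×ˢ Finset.range (N+1)).powerset))
  rintro _ ⟨x, ⟨hx, hN⟩, rfl⟩
  have := code_mem x hx hN
  simp only [code, Finset.mem_coe, Finset.mem_product]
  exact this

/-- cores of size at most `N` -/
def C (N : ℕ) : Finset OBCore := (finite N).toFinset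

lemma mem_C {N : ℕ} {x : OBCore} : x ∈ C N ↔ x.Valid ∧ x.size ≤ N := by
  simp [C]

lemma C_mono {M N : ℕ} (h : M ≤ N) : C M ⊆ C N := by
  intro x hx
  rw [mem_C] at *
  exact ⟨hx.1, hx.2.trans h⟩

open Classical in
/-- cores with few distinct parts -/
def Few (D N : ℕ) : Finset OBCore :=
  (C N).filter fun x => x.A.card < D ∧ x.B.card < D ∧ x.P.toFinset.card < D

lemma card_small_subsets {α : Type*} (T : Finset α) (D : ℕ) :
    (T.powerset.filter fun s => s.card < D).card ≤ D * (T.card + 1) ^ D := by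
  classical
  have : (T.powerset.filter fun s => s.card < D) ⊆
      (Finset.range D).biUnion fun d => T.powersetCard d := by
    intro s hs
    simp only [Finset.mem_filter, Finset.mem_powerset] at hs
    simp only [Finset.mem_biUnion, Finset.mem_range, Finset.mem_powersetCard]
    exact ⟨_, hs.2, hs.1, rfl⟩
  refine (Finset.card_le_card this).trans ?_
  refine (Finset.card_biUnion_le_card_mul _ _ ((T.card + 1) ^ D) ?_).trans (by simp)
  intro d hd
  rw [Finset.card_powersetCard]
  refine (Nat.choose_le_pow _ _).trans ?_
  refine (Nat.pow_le_pow_left (Nat.le_succ _) d).trans ?_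
  exact Nat.pow_le_pow_right (Nat.succ_pos _) (Finset.mem_range.1 hd).le

lemma card_Few (D N : ℕ) : (Few D N).card ≤ D ^ 3 * (N + 2) ^ (4 * D + 1) := by
  classical
  set S := (Finset.range (N+1)).powerset.filter fun s => s.card < D
  set S' := (Finset.range (N+1) ×ˢ Finset.range (N+1)).powerset.filter fun s => s.card < D
  have h1 : (Few D N).card ≤ (Finset.range (N+1) ×ˢ S ×ˢ S ×ˢ S').card := by
    apply Finset.card_le_card_of_injOn code _ code_inj.injOn
    intro x hx
    simp only [Few, Finset.coe_filter, Set.mem_ofPred_eq, mem_C] at hx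
    have := code_mem x hx.1.1 hx.1.2
    simp only [code, Finset.mem_coe, Finset.mem_product, S, S', Finset.mem_filter, gr_card]
    exact ⟨this.1, ⟨this.2.1, hx.2.1⟩, ⟨this.2.2.1, hx.2.2.1⟩, this.2.2.2, hx.2.2.2⟩
  have h2 : S.card ≤ D * (N + 2) ^ D := by
    simpa using card_small_subsets (Finset.range (N+1)) D
  have h3 : S'.card ≤ D * (N + 2) ^ (2 * D) := by
    refine (card_small_subsets (Finset.range (N+1) ×ˢ Finset.range (N+1)) D).trans ?_
    rw [pow_mul]
    apply Nat.mul_le_mul_left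
    apply Nat.pow_le_pow_left
    simp; nlinarith
  refine h1.trans ?_
  simp only [Finset.card_product, Finset.card_range]
  calc (N+1) * (S.card * (S.card * S'.card))
      ≤ (N+2) * ((D * (N + 2) ^ D) * ((D * (N + 2) ^ D) * (D * (N + 2) ^ (2 * D)))) := by
        gcongr; omega
    _ = _ := by ring

lemma lower (N : ℕ) (hN : 1 ≤ N) : 2 ^ Nat.sqrt N ≤ 2 * (C N).card := by
  classical
  set s := Nat.sqrt N with hs
  have hs1 : 1 ≤ s := Nat.le_sqrt'.2 (by simpa using hN)
  have hss : s * s ≤ N := Nat.sqrt_le N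
  obtain ⟨t, ht⟩ : ∃ t, s = t + 1 := ⟨s - 1, by omega⟩
  have : ((Finset.Icc 1 t).powerset).card ≤ (C N).card := by
    apply Finset.card_le_card_of_injOn (fun A => (⟨s, A, ∅, 0⟩ : OBCore))
    · intro A hA
      have hA : A ⊆ Finset.Icc 1 t := Finset.mem_powerset.1 (Finset.mem_coe.1 hA)
      simp only [Finset.mem_coe, mem_C, Valid, size]
      have hsum : ∑ a ∈ A, a ≤ t * t := by
        refine (Finset.sum_le_sum_of_subset hA).trans ?_
        refine (Finset.sum_le_card_nsmul _ _ t ?_).trans (by simp)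
        intro x hx; exact (Finset.mem_Icc.1 hx).2
      refine ⟨⟨hs1, ?_, by simp, by simp⟩, ?_⟩
      · intro a ha; have := Finset.mem_Icc.1 (hA ha); omega
      · simp; nlinarith
    · intro A _ A' _ h
      exact congrArg OBCore.A h
  rw [Finset.card_powerset] at this
  simp at this
  rw [ht, pow_succ]; omega

lemma C_pos {N : ℕ} (hN : 1 ≤ N) : 0 < (C N).card := by
  have := lower N hN
  have h2 : 0 < 2 ^ Nat.sqrt N := by positivity
  omega

lemma few_tendsto (D : ℕ) :
    Tendsto (fun N => ((Few D N).card : ℝ) / ((C N).card : ℝ)) atTop (𝓝 0) := by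
  have hsq : Tendsto Nat.sqrt atTop atTop := by
    apply tendsto_atTop_atTop.2
    intro b
    exact ⟨b * b, fun a ha => Nat.le_sqrt.2 ha⟩
  set E := 2 * (4 * D + 1)
  have h1 : Tendsto (fun s : ℕ => (2 * (D:ℝ) ^ 3 * 4) * (((s + 2 : ℕ) : ℝ) ^ E / 2 ^ (s + 2)))
      atTop (𝓝 0) := by
    have := (tendsto_pow_const_div_const_pow_of_one_lt E (r := (2:ℝ)) (by norm_num))
    have := (this.comp (tendsto_add_atTop_nat 2)).const_mul (2 * (D:ℝ) ^ 3 * 4)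
    simpa using this
  refine squeeze_zero' (Eventually.of_forall fun N => by positivity) ?_ (h1.comp hsq)
  filter_upwards [eventually_ge_atTop 1] with N hN
  have hl := lower N hN
  have hC := C_pos hN
  have hf := card_Few D N
  set s := Nat.sqrt N
  have hs : N + 2 ≤ (s + 2) ^ 2 := by
    have := Nat.lt_succ_sqrt N
    simp only [Nat.succ_eq_add_one] at this
    change N < (s+1) * (s+1) at this
    nlinarith
  have hf2 : (Few D N).card ≤ D ^ 3 * (s + 2) ^ E := by
    refine hf.trans ?_
    rw [pow_mul]
    gcongr
  have hf3 : ((Few D N).card : ℝ) ≤ D ^ 3 * ((s + 2 : ℕ) : ℝ) ^ E := by exact_mod_cast hf2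
  have hl3 : (2:ℝ) ^ s ≤ 2 * ((C N).card : ℝ) := by exact_mod_cast hl
  have hC3 : (0:ℝ) < ((C N).card : ℝ) := by exact_mod_cast hC
  simp only [Function.comp]
  change _ ≤ (2 * (D:ℝ) ^ 3 * 4) * (((s + 2 : ℕ) : ℝ) ^ E / 2 ^ (s + 2))
  rw [pow_add, div_le_iff₀ hC3]
  calc ((Few D N).card : ℝ) ≤ D ^ 3 * ((s + 2 : ℕ) : ℝ) ^ E := hf3
    _ = (D ^ 3 * ((s + 2 : ℕ) : ℝ) ^ E) * (2 ^ s / 2 ^ s) := by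
        rw [div_self (by positivity), mul_one]
    _ ≤ (D ^ 3 * ((s + 2 : ℕ) : ℝ) ^ E) * ((2 * ((C N).card : ℝ)) / 2 ^ s) := by gcongr
    _ = _ := by field_simp; ring

open Classical in
/-- cores of size exactly `N` -/
def U (N : ℕ) : Finset OBCore := (C N).filter fun x => x.size = N

lemma mem_U {N : ℕ} {x : OBCore} : x ∈ U N ↔ x.Valid ∧ x.size = N := by
  simp only [U, Finset.mem_filter, mem_C]
  constructor
  · rintro ⟨⟨h, _⟩, h2⟩; exact ⟨h, h2⟩
  · rintro ⟨h, h2⟩; exact ⟨⟨h, h2.le⟩, h2⟩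

lemma mul_card_le (S T : Finset OBCore) (D : ℕ) (g : OBCore → Finset ℕ) (f : OBCore → ℕ → OBCore)
    (hD : ∀ x ∈ S, D ≤ (g x).card) (hf : ∀ x ∈ S, ∀ l ∈ g x, f x l ∈ T)
    (hinj : ∀ x ∈ S, ∀ l ∈ g x, ∀ y ∈ S, ∀ m ∈ g y, f x l = f y m → x = y ∧ l = m) :
    D * S.card ≤ T.card := by
  have h1 : (S.sigma g).card ≤ T.card := by
    apply Finset.card_le_card_of_injOn (fun p => f p.1 p.2)
    · rintro ⟨x, l⟩ h
      have h := Finset.mem_sigma.1 (Finset.mem_coe.1 h)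
      exact hf x h.1 l h.2
    · rintro ⟨x, l⟩ h ⟨y, m⟩ h' e
      have h := Finset.mem_sigma.1 (Finset.mem_coe.1 h)
      have h' := Finset.mem_sigma.1 (Finset.mem_coe.1 h')
      obtain ⟨rfl, rfl⟩ := hinj x h.1 l h.2 y h'.1 m h'.2 e
      rfl
  rw [Finset.card_sigma] at h1
  have := Finset.card_nsmul_le_sum S (fun x => (g x).card) D hD
  rw [smul_eq_mul] at this
  rw [mul_comm]
  exact this.trans h1

lemma sum_erase_add {A : Finset ℕ} {l : ℕ} (h : l ∈ A) :
    ∑ a ∈ A.erase l, a + l = ∑ a ∈ A, a := Finset.sum_erase_add A (fun a => a) h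

lemma u_A (D N : ℕ) (S : Finset OBCore) (hS : S ⊆ U N) (hD : ∀ x ∈ S, D ≤ x.A.card) :
    D * S.card ≤ (C N).card := by
  refine mul_card_le S (C N) D (fun x => x.A) (fun x l => ⟨x.k, x.A.erase l, x.B, x.P⟩) hD ?_ ?_
  · intro x hx l hl
    obtain ⟨hv, hs⟩ := mem_U.1 (hS hx)
    have h1 := sum_erase_add hl
    rw [mem_C]
    refine ⟨⟨hv.1, fun a ha => hv.2.1 a (Finset.mem_of_mem_erase ha), hv.2.2⟩, ?_⟩
    simp only [size] at hs ⊢; omega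
  · intro x hx l hl y hy m hm e
    obtain ⟨hv, hs⟩ := mem_U.1 (hS hx)
    obtain ⟨hv', hs'⟩ := mem_U.1 (hS hy)
    have h1 := sum_erase_add hl
    have h2 := sum_erase_add hm
    simp only [OBCore.mk.injEq] at e
    obtain ⟨e1, e2, e3, e4⟩ := e
    simp only [size, e1, e3, e4] at hs hs'
    rw [e2] at h1
    have hlm : l = m := by omega
    subst hlm
    refine ⟨OBCore.ext e1 ?_ e3 e4, rfl⟩
    rw [← Finset.insert_erase hl, ← Finset.insert_erase hm, e2]

lemma u_B (D N : ℕ) (S : Finset OBCore) (hS : S ⊆ U N) (hD : ∀ x ∈ S, D ≤ x.B.card) :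
    D * S.card ≤ (C N).card := by
  refine mul_card_le S (C N) D (fun x => x.B) (fun x l => ⟨x.k, x.A, x.B.erase l, x.P⟩) hD ?_ ?_
  · intro x hx l hl
    obtain ⟨hv, hs⟩ := mem_U.1 (hS hx)
    have h1 := sum_erase_add hl
    rw [mem_C]
    refine ⟨⟨hv.1, hv.2.1, fun a ha => hv.2.2.1 a (Finset.mem_of_mem_erase ha), hv.2.2.2⟩, ?_⟩
    simp only [size] at hs ⊢; omega
  · intro x hx l hl y hy m hm e
    obtain ⟨hv, hs⟩ := mem_U.1 (hS hx)
    obtain ⟨hv', hs'⟩ := mem_U.1 (hS hy)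
    have h1 := sum_erase_add hl
    have h2 := sum_erase_add hm
    simp only [OBCore.mk.injEq] at e
    obtain ⟨e1, e2, e3, e4⟩ := e
    simp only [size, e1, e2, e4] at hs hs'
    rw [e3] at h1
    have hlm : l = m := by omega
    subst hlm
    refine ⟨OBCore.ext e1 e2 ?_ e4, rfl⟩
    rw [← Finset.insert_erase hl, ← Finset.insert_erase hm, e3]

lemma u_P (D N : ℕ) (S : Finset OBCore) (hS : S ⊆ U N) (hD : ∀ x ∈ S, D ≤ x.P.toFinset.card) :
    D * S.card ≤ (C N).card := by
  refine mul_card_le S (C N) D (fun x => x.P.toFinset) (fun x l => ⟨x.k, x.A, x.B, x.P.erase l⟩)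
    hD ?_ ?_
  · intro x hx l hl
    obtain ⟨hv, hs⟩ := mem_U.1 (hS hx)
    have h1 := Multiset.sum_erase (Multiset.mem_toFinset.1 hl)
    rw [mem_C]
    refine ⟨⟨hv.1, hv.2.1, hv.2.2.1, fun a ha => hv.2.2.2 a (Multiset.mem_of_mem_erase ha)⟩, ?_⟩
    simp only [size] at hs ⊢; omega
  · intro x hx l hl y hy m hm e
    obtain ⟨hv, hs⟩ := mem_U.1 (hS hx)
    obtain ⟨hv', hs'⟩ := mem_U.1 (hS hy)
    have h1 := Multiset.sum_erase (Multiset.mem_toFinset.1 hl)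
    have h2 := Multiset.sum_erase (Multiset.mem_toFinset.1 hm)
    simp only [OBCore.mk.injEq] at e
    obtain ⟨e1, e2, e3, e4⟩ := e
    simp only [size, e1, e2, e3] at hs hs'
    rw [e4] at h1
    have hlm : l = m := by omega
    subst hlm
    refine ⟨OBCore.ext e1 e2 e3 ?_, rfl⟩
    rw [← Multiset.cons_erase (Multiset.mem_toFinset.1 hl),
      ← Multiset.cons_erase (Multiset.mem_toFinset.1 hm), e4]

lemma u_bound (D N : ℕ) : D * (U N).card ≤ D * (Few D N).card + 3 * (C N).card := by
  classical
  have hsub : U N ⊆ Few D N ∪ (((U N).filter fun x => D ≤ x.A.card) ∪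
      (((U N).filter fun x => D ≤ x.B.card) ∪ ((U N).filter fun x => D ≤ x.P.toFinset.card))) := by
    intro x hx
    have hx' : x ∈ C N := (Finset.mem_filter.1 hx).1
    simp only [Finset.mem_union, Finset.mem_filter, Few, hx, hx', true_and]
    omega
  have h1 := (Finset.card_le_card hsub).trans (Finset.card_union_le _ _)
  have h2 := Finset.card_union_le ((U N).filter fun x => D ≤ x.A.card)
      (((U N).filter fun x => D ≤ x.B.card) ∪ ((U N).filter fun x => D ≤ x.P.toFinset.card))
  have h3 := Finset.card_union_le
      ((U N).filter fun x => D ≤ x.B.card) ((U N).filter fun x => D ≤ x.P.toFinset.card)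
  have a1 := u_A D N ((U N).filter fun x => D ≤ x.A.card) (Finset.filter_subset _ _)
    (fun x hx => (Finset.mem_filter.1 hx).2)
  have a2 := u_B D N ((U N).filter fun x => D ≤ x.B.card) (Finset.filter_subset _ _)
    (fun x hx => (Finset.mem_filter.1 hx).2)
  have a3 := u_P D N ((U N).filter fun x => D ≤ x.P.toFinset.card) (Finset.filter_subset _ _)
    (fun x hx => (Finset.mem_filter.1 hx).2)
  have := Nat.mul_le_mul_left D (h1.trans (Nat.add_le_add_left (h2.trans (Nat.add_le_add_left h3 _)) _))
  simp only [mul_add] at this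
  omega

lemma u_tendsto : Tendsto (fun N => ((U N).card : ℝ) / ((C N).card : ℝ)) atTop (𝓝 0) := by
  rw [Metric.tendsto_atTop]
  intro ε hε
  obtain ⟨D, hD⟩ := exists_nat_gt (6 / ε)
  have hDpos : (0:ℝ) < D := lt_trans (by positivity) hD
  have h1 := (Metric.tendsto_atTop.1 (few_tendsto D)) (ε / 2) (by positivity)
  obtain ⟨N0, hN0⟩ := h1
  refine ⟨max N0 1, fun N hN => ?_⟩
  have h2 := hN0 N (le_of_max_le_left hN)
  have hC : (0:ℝ) < ((C N).card : ℝ) := by exact_mod_cast C_pos (le_of_max_le_right hN)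
  rw [Real.dist_eq, sub_zero, abs_of_nonneg (by positivity)] at h2 ⊢
  rw [div_lt_iff₀ hC] at h2 ⊢
  have h3 : (D : ℝ) * (U N).card ≤ D * (Few D N).card + 3 * (C N).card := by
    exact_mod_cast u_bound D N
  rw [div_lt_iff₀ hε] at hD
  have h4 : (D:ℝ) * (Few D N).card < D * (ε / 2 * (C N).card) := by gcongr
  have h5 : 6 * ((C N).card : ℝ) < D * ε * (C N).card := by gcongr
  have : (D:ℝ) * (U N).card < D * (ε * (C N).card) := by nlinarith
  exact lt_of_mul_lt_mul_left this hDpos.le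

/-! ### The near-top cores are negligible -/

open Classical in
def Top (J N : ℕ) : Finset OBCore := (C N).filter fun x => N < x.size + J

lemma top_tendsto (J : ℕ) :
    Tendsto (fun N => ((Top J N).card : ℝ) / ((C N).card : ℝ)) atTop (𝓝 0) := by
  have h1 : Tendsto (fun N => ∑ i ∈ Finset.range J, ((U (N - i)).card : ℝ) / ((C (N - i)).card : ℝ))
      atTop (𝓝 0) := by
    rw [← Finset.sum_const_zero (s := Finset.range J) (ι := ℕ)]
    apply tendsto_finsetSum
    intro i _
    exact u_tendsto.comp (tendsto_sub_atTop_nat i)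
  refine squeeze_zero' (Eventually.of_forall fun N => by positivity) ?_ h1
  filter_upwards [eventually_ge_atTop (J + 1)] with N hN
  have hsub : (Top J N).card ≤ ∑ i ∈ Finset.range J, (U (N - i)).card := by
    classical
    refine (Finset.card_le_card ?_).trans (Finset.card_biUnion_le)
    intro x hx
    simp only [Top, Finset.mem_filter, mem_C] at hx
    simp only [Finset.mem_biUnion, Finset.mem_range, mem_U]
    exact ⟨N - x.size, by omega, hx.1.1, by omega⟩
  have hC : (0:ℝ) < ((C N).card : ℝ) := by exact_mod_cast C_pos (by omega)
  calc ((Top J N).card : ℝ) / ((C N).card : ℝ)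
      ≤ (∑ i ∈ Finset.range J, ((U (N - i)).card : ℝ)) / ((C N).card : ℝ) := by
        gcongr; exact_mod_cast hsub
    _ = ∑ i ∈ Finset.range J, ((U (N - i)).card : ℝ) / ((C N).card : ℝ) := by
        rw [Finset.sum_div]
    _ ≤ _ := by
        apply Finset.sum_le_sum
        intro i hi
        have hi := Finset.mem_range.1 hi
        have hC' : (0:ℝ) < ((C (N-i)).card : ℝ) := by exact_mod_cast C_pos (by omega)
        have : ((C (N-i)).card : ℝ) ≤ ((C N).card : ℝ) := by
          exact_mod_cast Finset.card_le_card (C_mono (Nat.sub_le N i))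
        gcongr

/-! ### Exponential sums over cores -/

def V (z : ℂ) (N : ℕ) : ℂ := ∑ x ∈ C N, z ^ x.rk

open Classical in
def Rr (M N : ℕ) : Finset OBCore := (C N).filter fun x =>
  M < x.k ∧ (∀ a ∈ x.A, M < a) ∧ (∀ a ∈ x.B, M < a) ∧ x.size + M * (M + 1) ≤ N

def glue (p : OBCore × Finset ℕ × Finset ℕ) : OBCore :=
  ⟨p.1.k, p.1.A ∪ p.2.1, p.1.B ∪ p.2.2, p.1.P⟩

def Q (M : ℕ) : Finset (Finset ℕ) := (Finset.Icc 1 M).powerset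

lemma two_mul_sum_le {M : ℕ} {S : Finset ℕ} (h : S ∈ Q M) : 2 * ∑ a ∈ S, a ≤ M * (M + 1) := by
  have h := Finset.mem_powerset.1 h
  have h1 : ∑ a ∈ S, a ≤ ∑ a ∈ Finset.range (M + 1), a := by
    apply Finset.sum_le_sum_of_subset
    intro x hx; have := Finset.mem_Icc.1 (h hx); simp; omega
  have := Finset.sum_range_id_mul_two (M + 1)
  simp at this
  nlinarith

lemma disj {M : ℕ} {A S : Finset ℕ} (hA : ∀ a ∈ A, M < a) (h : S ∈ Q M) : Disjoint A S := by
  rw [Finset.disjoint_left]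
  intro a ha hs
  have := hA a ha
  have := Finset.mem_Icc.1 (Finset.mem_powerset.1 h hs)
  omega

lemma rec_A {M : ℕ} {A S : Finset ℕ} (hA : ∀ a ∈ A, M < a) (h : S ∈ Q M) :
    A = (A ∪ S).filter (fun a => M < a) := by
  ext a
  simp only [Finset.mem_filter, Finset.mem_union]
  have h1 := hA a
  have h2 : a ∈ S → a ≤ M := fun hs => (Finset.mem_Icc.1 (Finset.mem_powerset.1 h hs)).2
  by_cases a ∈ A <;> by_cases a ∈ S <;> simp_all

lemma rec_S {M : ℕ} {A S : Finset ℕ} (hA : ∀ a ∈ A, M < a) (h : S ∈ Q M) :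
    S = (A ∪ S).filter (fun a => a ≤ M) := by
  ext a
  simp only [Finset.mem_filter, Finset.mem_union]
  have h1 := hA a
  have h2 : a ∈ S → a ≤ M := fun hs => (Finset.mem_Icc.1 (Finset.mem_powerset.1 h hs)).2
  by_cases a ∈ A <;> by_cases a ∈ S <;> simp_all

lemma glue_inj (M N : ℕ) : Set.InjOn glue (Rr M N ×ˢ Q M ×ˢ Q M : Finset _) := by
  rintro ⟨x, S, T⟩ h ⟨x', S', T'⟩ h' e
  simp only [Finset.mem_coe, Finset.mem_product, Rr, Finset.mem_filter] at h h'
  obtain ⟨⟨_, _, hA, hB, _⟩, hS, hT⟩ := h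
  obtain ⟨⟨_, _, hA', hB', _⟩, hS', hT'⟩ := h'
  simp only [glue, OBCore.mk.injEq] at e
  obtain ⟨e1, e2, e3, e4⟩ := e
  have a1 : x.A = x'.A := by rw [rec_A hA hS, rec_A hA' hS', e2]
  have a2 : S = S' := by rw [rec_S hA hS, rec_S hA' hS', e2]
  have a3 : x.B = x'.B := by rw [rec_A hB hT, rec_A hB' hT', e3]
  have a4 : T = T' := by rw [rec_S hB hT, rec_S hB' hT', e3]
  have a5 : x = x' := OBCore.ext e1 a1 a3 e4
  rw [a2, a4, a5]

lemma glue_mem {M N : ℕ} {x : OBCore} {S T : Finset ℕ} (hx : x ∈ Rr M N) (hS : S ∈ Q M)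
    (hT : T ∈ Q M) : glue (x, S, T) ∈ C N := by
  simp only [Rr, Finset.mem_filter, mem_C] at hx
  obtain ⟨⟨hv, _⟩, hk, hA, hB, hs⟩ := hx
  have h1 := two_mul_sum_le hS
  have h2 := two_mul_sum_le hT
  have hS' := Finset.mem_powerset.1 hS
  have hT' := Finset.mem_powerset.1 hT
  rw [mem_C]
  refine ⟨⟨hv.1, ?_, ?_, hv.2.2.2⟩, ?_⟩
  · intro a ha
    rcases Finset.mem_union.1 ha with h | h
    · exact hv.2.1 a h
    · have := Finset.mem_Icc.1 (hS' h); simp only [glue]; omega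
  · intro a ha
    rcases Finset.mem_union.1 ha with h | h
    · exact hv.2.2.1 a h
    · have := Finset.mem_Icc.1 (hT' h); simp only [glue]; omega
  · simp only [size, glue] at hs ⊢
    rw [Finset.sum_union (disj hA hS), Finset.sum_union (disj hB hT)]
    omega

lemma rest_mem {M N : ℕ} {x : OBCore} (hx : x ∈ C N) (hk : M < x.k)
    (hs : x.size + M * (M + 1) ≤ N) : ∃ p ∈ Rr M N ×ˢ Q M ×ˢ Q M, glue p = x := by
  obtain ⟨hv, _⟩ := mem_C.1 hx
  have hsz : (⟨x.k, x.A.filter (fun a => M < a), x.B.filter (fun a => M < a), x.P⟩ : OBCore).size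
      ≤ x.size := by
    simp only [size]
    have h1 : ∑ a ∈ x.A.filter (fun a => M < a), a ≤ ∑ a ∈ x.A, a :=
      Finset.sum_le_sum_of_subset (Finset.filter_subset _ _)
    have h2 : ∑ a ∈ x.B.filter (fun a => M < a), a ≤ ∑ a ∈ x.B, a :=
      Finset.sum_le_sum_of_subset (Finset.filter_subset _ _)
    omega
  refine ⟨(⟨x.k, x.A.filter (fun a => M < a), x.B.filter (fun a => M < a), x.P⟩,
    x.A.filter (fun a => ¬ M < a), x.B.filter (fun a => ¬ M < a)), ?_, ?_⟩
  · simp only [Finset.mem_product, Rr, Finset.mem_filter, mem_C, Q, Finset.mem_powerset]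
    refine ⟨⟨⟨⟨hv.1, ?_, ?_, hv.2.2.2⟩, by omega⟩, hk, ?_, ?_, by omega⟩, ?_, ?_⟩
    · intro a ha; exact hv.2.1 a (Finset.mem_filter.1 ha).1
    · intro a ha; exact hv.2.2.1 a (Finset.mem_filter.1 ha).1
    · intro a ha; exact ha.2
    · intro a ha; exact ha.2
    · intro a ha
      have h := Finset.mem_filter.1 ha
      have := hv.2.1 a h.1
      rw [Finset.mem_Icc]; omega
    · intro a ha
      have h := Finset.mem_filter.1 ha
      have := hv.2.2.1 a h.1
      rw [Finset.mem_Icc]; omega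
  · apply OBCore.ext
    · rfl
    · exact Finset.filter_union_filter_not_eq _ _
    · exact Finset.filter_union_filter_not_eq _ _
    · rfl

lemma sum_Q (M : ℕ) (z : ℂ) : ∑ S ∈ Q M, z ^ S.card = (1 + z) ^ M := by
  have := Finset.sum_pow_mul_eq_add_pow z 1 (Finset.Icc 1 M)
  simp at this
  rw [Q, this, add_comm]

lemma sum_glue (M N : ℕ) (z : ℂ) (hz : z ≠ 0) :
    ∑ p ∈ Rr M N ×ˢ Q M ×ˢ Q M, z ^ (glue p).rk =
      (∑ x ∈ Rr M N, z ^ x.rk) * ((1 + z⁻¹) ^ M * (1 + z) ^ M) := by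
  rw [← sum_Q, ← sum_Q, Finset.sum_mul_sum, ← Finset.sum_product', Finset.sum_mul_sum,
    ← Finset.sum_product']
  apply Finset.sum_congr rfl
  rintro ⟨x, S, T⟩ h
  simp only [Finset.mem_product, Rr, Finset.mem_filter] at h
  obtain ⟨⟨_, _, hA, hB, _⟩, hS, hT⟩ := h
  simp only [rk, glue]
  rw [Finset.card_union_of_disjoint (disj hA hS), Finset.card_union_of_disjoint (disj hB hT)]
  rw [inv_pow, ← zpow_natCast, ← zpow_natCast, ← zpow_neg, ← zpow_add₀ hz, ← zpow_add₀ hz]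
  congr 1
  push_cast
  ring

lemma low_few {M N : ℕ} {x : OBCore} (hx : x ∈ C N) (hk : x.k ≤ M) : x ∈ Few (2 * M + 1) N := by
  classical
  obtain ⟨hv, _⟩ := mem_C.1 hx
  simp only [Few, Finset.mem_filter, hx, true_and]
  have key : ∀ S : Finset ℕ, (∀ a ∈ S, a < 2 * M) → S.card < 2 * M + 1 := by
    intro S hS
    have : S ⊆ Finset.range (2 * M) := fun a ha => Finset.mem_range.2 (hS a ha)
    have := Finset.card_le_card this
    simp at this; omega
  refine ⟨key _ ?_, key _ ?_, key _ ?_⟩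
  · intro a ha; have := hv.2.1 a ha; omega
  · intro a ha; have := hv.2.2.1 a ha; omega
  · intro a ha; have := hv.2.2.2 a (Multiset.mem_toFinset.1 ha); omega

lemma norm_sum_le (S : Finset OBCore) (z : ℂ) (hz : ‖z‖ = 1) :
    ‖∑ x ∈ S, z ^ x.rk‖ ≤ S.card := by
  refine (_root_.norm_sum_le _ _).trans ?_
  simp [norm_zpow, hz]

lemma V_bound (M N : ℕ) (z : ℂ) (hz : ‖z‖ = 1) :
    ‖V z N‖ ≤ (‖1 + z‖ / 2) ^ (2 * M) * (C N).card + (Few (2 * M + 1) N).card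
      + (Top (M * (M + 1)) N).card := by
  classical
  have hz0 : z ≠ 0 := by intro h; simp [h] at hz
  set I := (Rr M N ×ˢ Q M ×ˢ Q M).image glue with hI
  have hIC : I ⊆ C N := by
    intro x hx
    obtain ⟨⟨y, S, T⟩, hp, rfl⟩ := Finset.mem_image.1 hx
    simp only [Finset.mem_product] at hp
    exact glue_mem hp.1 hp.2.1 hp.2.2
  have hIcard : I.card = (Rr M N).card * 4 ^ M := by
    rw [hI, Finset.card_image_of_injOn (glue_inj M N)]
    simp only [Finset.card_product, Q, Finset.card_powerset, Nat.card_Icc]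
    rw [← mul_pow]; simp
  have hinv : ‖1 + z⁻¹‖ = ‖1 + z‖ := by
    have : 1 + z⁻¹ = (1 + z) * z⁻¹ := by field_simp; ring
    rw [this, norm_mul, norm_inv, hz]; simp
  have h1 : ‖∑ x ∈ I, z ^ x.rk‖ ≤ (‖1 + z‖ / 2) ^ (2 * M) * (C N).card := by
    rw [hI, Finset.sum_image (glue_inj M N), sum_glue M N z hz0, norm_mul, norm_mul, norm_pow,
      norm_pow, hinv]
    calc ‖∑ x ∈ Rr M N, z ^ x.rk‖ * (‖1 + z‖ ^ M * ‖1 + z‖ ^ M)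
        ≤ (Rr M N).card * (‖1 + z‖ ^ M * ‖1 + z‖ ^ M) := by
          gcongr; exact norm_sum_le _ z hz
      _ = (‖1 + z‖ / 2) ^ (2 * M) * (I.card : ℝ) := by
          rw [hIcard, pow_mul, div_pow, div_pow, ← mul_pow]
          push_cast
          norm_num
          field_simp
      _ ≤ _ := by
          gcongr
  have h2 : C N \ I ⊆ Few (2 * M + 1) N ∪ Top (M * (M + 1)) N := by
    intro x hx
    obtain ⟨hx, hxI⟩ := Finset.mem_sdiff.1 hx
    by_contra hcon
    rw [Finset.mem_union, not_or] at hcon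
    apply hxI
    rw [hI, Finset.mem_image]
    apply rest_mem hx
    · by_contra hk
      exact hcon.1 (low_few hx (by omega))
    · by_contra hk
      exact hcon.2 (Finset.mem_filter.2 ⟨hx, by omega⟩)
  have h3 : ((C N \ I).card : ℝ) ≤ (Few (2 * M + 1) N).card + (Top (M * (M + 1)) N).card := by
    exact_mod_cast (Finset.card_le_card h2).trans (Finset.card_union_le _ _)
  rw [V, ← Finset.sum_sdiff hIC]
  have h4 := norm_add_le (∑ x ∈ C N \ I, z ^ x.rk) (∑ x ∈ I, z ^ x.rk)
  have h5 := norm_sum_le (C N \ I) z hz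
  linarith

lemma norm_lt {z : ℂ} (hz : ‖z‖ = 1) (h1 : z ≠ 1) : ‖1 + z‖ / 2 < 1 := by
  have hne : ¬ SameRay ℝ (1 : ℂ) z := by
    intro h
    have := h.eq_of_norm_eq (by simp [hz])
    exact h1 this.symm
  have := norm_add_lt_of_not_sameRay hne
  simp [hz] at this
  linarith

lemma V_tendsto {z : ℂ} (hz : ‖z‖ = 1) (h1 : z ≠ 1) :
    Tendsto (fun N => ‖V z N‖ / ((C N).card : ℝ)) atTop (𝓝 0) := by
  rw [Metric.tendsto_atTop]
  intro ε hε
  set ρ := ‖1 + z‖ / 2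
  have hρ : ρ < 1 := norm_lt hz h1
  have hρ0 : 0 ≤ ρ := by positivity
  obtain ⟨M, hM⟩ := exists_pow_lt_of_lt_one (show 0 < ε / 3 by positivity) hρ
  have hM2 : ρ ^ (2 * M) < ε / 3 :=
    lt_of_le_of_lt (pow_le_pow_of_le_one hρ0 hρ.le (by omega)) hM
  obtain ⟨N1, hN1⟩ := (Metric.tendsto_atTop.1 (few_tendsto (2 * M + 1))) (ε / 3) (by positivity)
  obtain ⟨N2, hN2⟩ := (Metric.tendsto_atTop.1 (top_tendsto (M * (M + 1)))) (ε / 3) (by positivity)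
  refine ⟨max (max N1 N2) 1, fun N hN => ?_⟩
  have a1 := hN1 N (by omega)
  have a2 := hN2 N (by omega)
  have hC : (0:ℝ) < ((C N).card : ℝ) := by exact_mod_cast C_pos (by omega)
  rw [Real.dist_eq, sub_zero, abs_of_nonneg (by positivity)] at a1 a2 ⊢
  rw [div_lt_iff₀ hC] at a1 a2 ⊢
  have a3 := V_bound M N z hz
  have a4 : ρ ^ (2 * M) * ((C N).card : ℝ) < ε / 3 * (C N).card := by gcongr
  linarith

open Classical in
def Cm (a : ℤ) (c N : ℕ) : Finset OBCore := (C N).filter fun x => x.rk ≡ a [ZMOD (c : ℤ)]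

lemma fourier (a : ℤ) (c N : ℕ) (hc : 1 < c) {ζ : ℂ} (hζ : IsPrimitiveRoot ζ c) :
    (c : ℂ) * (Cm a c N).card = ∑ j ∈ Finset.range c, (ζ ^ j) ^ (-a) * V (ζ ^ j) N := by
  classical
  have hζ0 : ζ ≠ 0 := hζ.ne_zero (by omega)
  simp only [V, Finset.mul_sum]
  rw [Finset.sum_comm]
  rw [Cm, Finset.card_filter]
  push_cast
  rw [Finset.mul_sum]
  apply Finset.sum_congr rfl
  intro x _
  have h : ∀ j : ℕ, (ζ ^ j) ^ (-a) * (ζ ^ j) ^ x.rk = (ζ ^ (x.rk - a)) ^ j := by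
    intro j
    rw [← zpow_add₀ (pow_ne_zero _ hζ0), ← zpow_natCast, ← zpow_natCast, ← zpow_mul, ← zpow_mul]
    congr 1; ring
  simp only [h]
  by_cases hx : x.rk ≡ a [ZMOD (c : ℤ)]
  · have : ζ ^ (x.rk - a) = 1 := (hζ.zpow_eq_one_iff_dvd _).2 hx.symm.dvd
    simp [hx, this]
  · have hne : ζ ^ (x.rk - a) ≠ 1 := by
      intro h
      exact hx (Int.modEq_iff_dvd.2 ((hζ.zpow_eq_one_iff_dvd _).1 h)).symm
    rw [geom_sum_eq hne]
    have : (ζ ^ (x.rk - a)) ^ c = 1 := by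
      rw [← zpow_natCast, ← zpow_mul, mul_comm, zpow_mul, zpow_natCast, hζ.pow_eq_one, one_zpow]
    simp [hx, this]

lemma main (a : ℤ) (c : ℕ) (hc : 1 < c) :
    Tendsto (fun N => (c : ℝ) * ((Cm a c N).card : ℝ) / ((C N).card : ℝ)) atTop (𝓝 1) := by
  obtain ⟨ζ, hζ⟩ : ∃ ζ : ℂ, IsPrimitiveRoot ζ c := ⟨_, Complex.isPrimitiveRoot_exp c (by omega)⟩
  have hn : ‖ζ‖ = 1 := hζ.norm'_eq_one (by omega)
  obtain ⟨d, rfl⟩ : ∃ d, c = d + 1 := ⟨c - 1, by omega⟩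
  have h0 : Tendsto (fun N => ∑ j ∈ Finset.range d, ‖V (ζ ^ (j + 1)) N‖ / ((C N).card : ℝ))
      atTop (𝓝 0) := by
    rw [← Finset.sum_const_zero (s := Finset.range d) (ι := ℕ)]
    apply tendsto_finsetSum
    intro j hj
    apply V_tendsto
    · rw [norm_pow, hn, one_pow]
    · exact hζ.pow_ne_one_of_pos_of_lt (by omega) (by have := Finset.mem_range.1 hj; omega)
  rw [tendsto_iff_norm_sub_tendsto_zero]
  refine squeeze_zero' (Eventually.of_forall fun N => norm_nonneg _) ?_ h0
  filter_upwards [eventually_ge_atTop 1] with N hN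
  have hC : (0:ℝ) < ((C N).card : ℝ) := by exact_mod_cast C_pos hN
  have hf := fourier a (d + 1) N hc hζ
  rw [Finset.sum_range_succ'] at hf
  have hV1 : V (ζ ^ 0) N = (C N).card := by simp [V]
  rw [hV1] at hf
  simp only [pow_zero, one_zpow, one_mul] at hf
  have h2 : ‖((d + 1 : ℕ) : ℝ) * ((Cm a (d + 1) N).card : ℝ) - ((C N).card : ℝ)‖ ≤
      ∑ j ∈ Finset.range d, ‖V (ζ ^ (j + 1)) N‖ := by
    rw [← Complex.norm_real]
    push_cast
    push_cast at hf
    rw [hf, add_sub_cancel_right]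
    refine (_root_.norm_sum_le _ _).trans ?_
    apply Finset.sum_le_sum
    intro j _
    rw [norm_mul, norm_zpow, norm_pow, hn]
    simp
  rw [← Finset.sum_div]
  rw [div_sub_one hC.ne', norm_div, Real.norm_of_nonneg hC.le]
  gcongr

end OBCore

/-! ### From lists to cores -/

namespace OBCore

lemma chain_iff (l : List ℕ) : l.IsChain (fun a b => a ≤ b ∧ (a = b → Odd a)) ↔
    l.Pairwise (· ≤ ·) ∧ ((l : Multiset ℕ).filter (fun x => x % 2 = 0)).Nodup := by
  have : Trans (fun a b : ℕ => a ≤ b ∧ (a = b → Odd a)) (fun a b : ℕ => a ≤ b ∧ (a = b → Odd a))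
      (fun a b : ℕ => a ≤ b ∧ (a = b → Odd a)) := ⟨by
    rintro a b c ⟨h1, h2⟩ ⟨h3, h4⟩
    refine ⟨h1.trans h3, fun h => h2 (by omega)⟩⟩
  rw [List.isChain_iff_pairwise, Multiset.filter_coe, Multiset.coe_nodup, List.nodup_iff_pairwise_ne,
    List.pairwise_filter, ← List.pairwise_and_iff]
  apply List.Pairwise.iff
  intro a b
  simp only [Nat.odd_iff, decide_eq_true_eq]
  constructor
  · rintro ⟨h1, h2⟩; refine ⟨h1, fun h3 h4 h5 => ?_⟩; have := h2 h5; omega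
  · rintro ⟨h1, h2⟩; refine ⟨h1, fun h3 => ?_⟩
    by_contra h4
    exact h2 (by omega) (by omega) h3

lemma sorted_eq {l₁ l₂ : List ℕ} (h₁ : l₁.Pairwise (· ≤ ·)) (h₂ : l₂.Pairwise (· ≤ ·))
    (h : (l₁ : Multiset ℕ) = l₂) : l₁ = l₂ :=
  List.Perm.eq_of_pairwise' h₁ h₂ (Multiset.coe_eq_coe.1 h)

lemma balanced_iff (L : List ℕ) (p : ℕ) (R : List ℕ) : IsOddBalanced L p R ↔
    p % 2 = 0 ∧ 0 < p ∧ (∀ x ∈ L, 0 < x ∧ x < p) ∧ (∀ x ∈ R, 0 < x ∧ x < p) ∧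
    L.Pairwise (· ≤ ·) ∧ ((L : Multiset ℕ).filter (fun x => x % 2 = 0)).Nodup ∧
    R.reverse.Pairwise (· ≤ ·) ∧ ((R : Multiset ℕ).filter (fun x => x % 2 = 0)).Nodup ∧
    (L : Multiset ℕ).filter (fun x => x % 2 = 1) = (R : Multiset ℕ).filter (fun x => x % 2 = 1) := by
  have hR : R.IsChain (fun a b => b ≤ a ∧ (a = b → Odd a)) ↔ R.reverse.Pairwise (· ≤ ·) ∧
      ((R : Multiset ℕ).filter (fun x => x % 2 = 0)).Nodup := by
    rw [← Multiset.coe_reverse R, ← chain_iff, List.isChain_reverse]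
    apply List.IsChain.iff
    intro a b
    constructor
    · rintro ⟨h1, h2⟩; exact ⟨h1, fun h => h ▸ h2 h.symm⟩
    · rintro ⟨h1, h2⟩; exact ⟨h1, fun h => h ▸ h2 h.symm⟩
  have hO : L.Pairwise (· ≤ ·) → R.reverse.Pairwise (· ≤ ·) →
      (L.filter (fun x => x % 2 == 1) = R.reverse.filter (fun x => x % 2 == 1) ↔
      (L : Multiset ℕ).filter (fun x => x % 2 = 1) = (R : Multiset ℕ).filter (fun x => x % 2 = 1)) := by
    intro h1 h2
    rw [← Multiset.coe_reverse R, Multiset.filter_coe, Multiset.filter_coe]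
    constructor
    · intro h
      exact congrArg _ h
    · intro h
      exact sorted_eq (h1.filter _) (h2.filter _) h
  unfold IsOddBalanced
  change (Even p ∧ 0 < p ∧ (∀ x ∈ L, 0 < x) ∧ (∀ x ∈ R, 0 < x) ∧
    L.IsChain (fun a b => a ≤ b ∧ (a = b → Odd a)) ∧
    R.IsChain (fun a b => b ≤ a ∧ (a = b → Odd a)) ∧ _) ↔ _
  rw [hR, chain_iff, Nat.even_iff]
  constructor
  · rintro ⟨a1, a2, a3, a4, ⟨a5, a6⟩, ⟨a7, a8⟩, a9, a10, a11⟩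
    exact ⟨a1, a2, fun x hx => ⟨a3 x hx, a9 x hx⟩, fun x hx => ⟨a4 x hx, a10 x hx⟩, a5, a6, a7, a8,
      (hO a5 a7).1 a11⟩
  · rintro ⟨a1, a2, a3, a4, a5, a6, a7, a8, a9⟩
    exact ⟨a1, a2, fun x hx => (a3 x hx).1, fun x hx => (a4 x hx).1, ⟨a5, a6⟩, ⟨a7, a8⟩,
      fun x hx => (a3 x hx).2, fun x hx => (a4 x hx).2, (hO a5 a7).2 a9⟩

def ms (E : Finset ℕ) (O : Multiset ℕ) : Multiset ℕ := E.val.map (fun a => 2 * a) + O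

def lst (E : Finset ℕ) (O : Multiset ℕ) : List ℕ := (ms E O).sort (· ≤ ·)

lemma lst_coe (E : Finset ℕ) (O : Multiset ℕ) : (lst E O : Multiset ℕ) = ms E O :=
  Multiset.sort_eq _ _

lemma lst_sorted (E : Finset ℕ) (O : Multiset ℕ) : (lst E O).Pairwise (· ≤ ·) :=
  Multiset.pairwise_sort _ _

lemma lst_length (E : Finset ℕ) (O : Multiset ℕ) : (lst E O).length = E.card + O.card := by
  rw [← Multiset.coe_card, lst_coe]; simp [ms]

lemma lst_sum (E : Finset ℕ) (O : Multiset ℕ) : (lst E O).sum = 2 * ∑ a ∈ E, a + O.sum := by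
  rw [← Multiset.sum_coe, lst_coe, ms, Multiset.sum_add, Finset.mul_sum]; rfl

lemma mem_lst {E : Finset ℕ} {O : Multiset ℕ} {x : ℕ} :
    x ∈ lst E O ↔ (∃ a ∈ E, 2 * a = x) ∨ x ∈ O := by
  rw [← Multiset.mem_coe, lst_coe, ms, Multiset.mem_add, Multiset.mem_map]; rfl

lemma ms_even (E : Finset ℕ) (O : Multiset ℕ) (hO : ∀ x ∈ O, x % 2 = 1) :
    (ms E O).filter (fun x => x % 2 = 0) = E.val.map (fun a => 2 * a) := by
  rw [ms, Multiset.filter_add, Multiset.filter_eq_self.2, Multiset.filter_eq_nil.2, add_zero]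
  · intro x hx; have := hO x hx; omega
  · intro x hx; obtain ⟨a, _, rfl⟩ := Multiset.mem_map.1 hx; omega

lemma ms_odd (E : Finset ℕ) (O : Multiset ℕ) (hO : ∀ x ∈ O, x % 2 = 1) :
    (ms E O).filter (fun x => x % 2 = 1) = O := by
  rw [ms, Multiset.filter_add, Multiset.filter_eq_nil.2, Multiset.filter_eq_self.2, zero_add]
  · exact hO
  · intro x hx; obtain ⟨a, _, rfl⟩ := Multiset.mem_map.1 hx; omega

lemma map_nodup (E : Finset ℕ) : (E.val.map (fun a => 2 * a)).Nodup :=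
  E.nodup.map (fun a b (h : 2 * a = 2 * b) => by omega)

/-- the odd parts, with ones -/
def odds (n : ℕ) (x : OBCore) : Multiset ℕ := x.P + Multiset.replicate (n + 1 - x.size) 1

def toL (n : ℕ) (x : OBCore) : List ℕ × ℕ × List ℕ :=
  (lst x.A (odds n x), 2 * x.k, (lst x.B (odds n x)).reverse)

lemma odds_odd {n : ℕ} {x : OBCore} (hx : x.Valid) : ∀ y ∈ odds n x, y % 2 = 1 := by
  intro y hy
  rcases Multiset.mem_add.1 hy with h | h
  · exact (hx.2.2.2 y h).1
  · rw [Multiset.eq_of_mem_replicate h]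

lemma odds_lt {n : ℕ} {x : OBCore} (hx : x.Valid) : ∀ y ∈ odds n x, 0 < y ∧ y < 2 * x.k := by
  intro y hy
  rcases Multiset.mem_add.1 hy with h | h
  · have := (hx.2.2.2 y h); omega
  · rw [Multiset.eq_of_mem_replicate h]; have := hx.1; omega

lemma toL_valid {n : ℕ} {x : OBCore} (hx : x.Valid) :
    IsOddBalanced (toL n x).1 (toL n x).2.1 (toL n x).2.2 := by
  have ho := odds_odd (n := n) hx
  have hl := odds_lt (n := n) hx
  rw [balanced_iff]
  simp only [toL, Multiset.coe_reverse, lst_coe, List.reverse_reverse, ms_even _ _ ho, ms_odd _ _ ho,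
    List.mem_reverse]
  have h0 := hx.1
  refine ⟨by omega, by omega, ?_, ?_, lst_sorted _ _, map_nodup _, lst_sorted _ _, map_nodup _, trivial⟩
  · intro y hy
    rcases mem_lst.1 hy with ⟨a, ha, rfl⟩ | h
    · have := hx.2.1 a ha; omega
    · exact hl y h
  · intro y hy
    rcases mem_lst.1 hy with ⟨a, ha, rfl⟩ | h
    · have := hx.2.2.1 a ha; omega
    · exact hl y h

lemma toL_sum {n : ℕ} {x : OBCore} (hs : x.size ≤ n + 1) :
    (toL n x).1.sum + (toL n x).2.1 + (toL n x).2.2.sum = 2 * n + 2 := by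
  simp only [toL, List.sum_reverse, lst_sum, odds, Multiset.sum_add, Multiset.sum_replicate]
  unfold size at hs ⊢
  simp only [smul_eq_mul, mul_one]
  omega

lemma toL_rank (n : ℕ) (x : OBCore) :
    ((toL n x).2.2.length : ℤ) - ((toL n x).1.length : ℤ) = x.rk := by
  simp only [toL, List.length_reverse, lst_length, rk]
  push_cast; ring

lemma toL_inj {n : ℕ} {x y : OBCore} (hx : x.Valid) (hy : y.Valid) (h : toL n x = toL n y) :
    x = y := by
  simp only [toL, Prod.mk.injEq, List.reverse_inj] at h
  obtain ⟨h1, h2, h3⟩ := h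
  have ox := odds_odd (n := n) hx
  have oy := odds_odd (n := n) hy
  have h1 : ms x.A (odds n x) = ms y.A (odds n y) := by rw [← lst_coe, h1, lst_coe]
  have h3 : ms x.B (odds n x) = ms y.B (odds n y) := by rw [← lst_coe, h3, lst_coe]
  have hmap : Function.Injective (fun a : ℕ => 2 * a) := fun a b h => by simp only at h; omega
  apply OBCore.ext
  · omega
  · apply Finset.val_injective
    apply Multiset.map_injective hmap
    rw [← ms_even _ _ ox, h1, ms_even _ _ oy]
  · apply Finset.val_injective
    apply Multiset.map_injective hmap
    rw [← ms_even _ _ ox, h3, ms_even _ _ oy]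
  · have e : odds n x = odds n y := by rw [← ms_odd x.A _ ox, h1, ms_odd _ _ oy]
    have key : ∀ z : OBCore, z.Valid → (odds n z).filter (fun a => 1 < a) = z.P := by
      intro z hz
      rw [odds, Multiset.filter_add, Multiset.filter_eq_self.2, Multiset.filter_eq_nil.2, add_zero]
      · intro a ha; rw [Multiset.eq_of_mem_replicate ha]; omega
      · intro a ha; have := hz.2.2.2 a ha; omega
    rw [← key x hx, e, key y hy]

/-- the halves of the even entries -/
def halves (L : List ℕ) : Finset ℕ :=
  (((L : Multiset ℕ).filter (fun x => x % 2 = 0)).toFinset).image (fun a => a / 2)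

lemma mem_halves {L : List ℕ} {a : ℕ} : a ∈ halves L ↔ 2 * a ∈ L := by
  simp only [halves, Finset.mem_image, Multiset.mem_toFinset, Multiset.mem_filter, Multiset.mem_coe]
  constructor
  · rintro ⟨b, ⟨h1, h2⟩, rfl⟩
    have : 2 * (b / 2) = b := by omega
    rwa [this]
  · intro h; exact ⟨2 * a, ⟨h, by omega⟩, by omega⟩

lemma halves_map {L : List ℕ} (h : ((L : Multiset ℕ).filter (fun x => x % 2 = 0)).Nodup) :
    (halves L).val.map (fun a => 2 * a) = (L : Multiset ℕ).filter (fun x => x % 2 = 0) := by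
  rw [Multiset.Nodup.ext (map_nodup _) h]
  intro a
  simp only [Multiset.mem_map, Finset.mem_val, mem_halves, Multiset.mem_filter, Multiset.mem_coe]
  constructor
  · rintro ⟨b, hb, rfl⟩; exact ⟨hb, by omega⟩
  · rintro ⟨h1, h2⟩; exact ⟨a / 2, by rwa [show 2 * (a / 2) = a by omega], by omega⟩

lemma ms_halves {L : List ℕ} (h : ((L : Multiset ℕ).filter (fun x => x % 2 = 0)).Nodup) :
    ms (halves L) ((L : Multiset ℕ).filter (fun x => x % 2 = 1)) = L := by
  rw [ms, halves_map h]
  conv_rhs => rw [← Multiset.filter_add_not (fun x => x % 2 = 0) (L : Multiset ℕ)]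
  congr 1
  apply Multiset.filter_congr
  intro x _; omega

lemma toL_surj {n : ℕ} {L : List ℕ} {p : ℕ} {R : List ℕ} (hb : IsOddBalanced L p R)
    (hs : L.sum + p + R.sum = 2 * n + 2) : ∃ x ∈ C (n + 1), toL n x = (L, p, R) := by
  rw [balanced_iff] at hb
  obtain ⟨b1, b2, b3, b4, b5, b6, b7, b8, b9⟩ := hb
  set O := (L : Multiset ℕ).filter (fun x => x % 2 = 1) with hO
  have hL : lst (halves L) O = L := sorted_eq (lst_sorted _ _) b5 (by rw [lst_coe, ms_halves b6])
  have hR : lst (halves R) O = R.reverse := sorted_eq (lst_sorted _ _) b7 (by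
    rw [lst_coe, b9, ms_halves b8, Multiset.coe_reverse])
  set P := O.filter (fun a => 1 < a) with hP
  have hOP : O = P + Multiset.replicate (O.count 1) 1 := by
    conv_lhs => rw [← Multiset.filter_add_not (fun x => 1 < x) O]
    rw [← Multiset.filter_eq']
    congr 1
    apply Multiset.filter_congr
    intro x hx
    have := (Multiset.mem_filter.1 hx).2
    omega
  have hOs : O.sum = P.sum + O.count 1 := by
    conv_lhs => rw [hOP]
    simp
  have hLs : L.sum = 2 * ∑ a ∈ halves L, a + O.sum := by rw [← lst_sum, hL]
  have hRs : R.sum = 2 * ∑ a ∈ halves R, a + O.sum := by rw [← lst_sum, hR, List.sum_reverse]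
  set x : OBCore := ⟨p / 2, halves L, halves R, P⟩ with hx
  have hsz : x.size + O.count 1 = n + 1 := by
    simp only [size, hx]; omega
  have hodds : odds n x = O := by
    rw [odds, hOP]
    congr 2
    omega
  refine ⟨x, mem_C.2 ⟨⟨?_, ?_, ?_, ?_⟩, by omega⟩, ?_⟩
  · simp only [hx]; omega
  · intro a ha; have := b3 _ (mem_halves.1 ha); simp only [hx]; omega
  · intro a ha; have := b4 _ (mem_halves.1 ha); simp only [hx]; omega
  · intro a ha
    obtain ⟨h1, h2⟩ := Multiset.mem_filter.1 (show a ∈ O.filter (fun a => 1 < a) from ha)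
    obtain ⟨h3, h4⟩ := Multiset.mem_filter.1 h1
    have := b3 a h3
    simp only [hx]; omega
  · simp only [toL, hodds]
    simp only [hx, hL, hR, List.reverse_reverse, Prod.mk.injEq, true_and, and_true]
    omega

lemma card_lists (n : ℕ) (q : ℤ → Prop) [DecidablePred q] :
    Nat.card {x : List ℕ × ℕ × List ℕ //
      IsOddBalanced x.1 x.2.1 x.2.2 ∧ x.1.sum + x.2.1 + x.2.2.sum = 2 * n + 2 ∧
      q ((x.2.2.length : ℤ) - (x.1.length : ℤ))} = ((C (n + 1)).filter fun x => q x.rk).card := by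
  classical
  have himg : {x : List ℕ × ℕ × List ℕ |
      IsOddBalanced x.1 x.2.1 x.2.2 ∧ x.1.sum + x.2.1 + x.2.2.sum = 2 * n + 2 ∧
      q ((x.2.2.length : ℤ) - (x.1.length : ℤ))} =
      (((C (n + 1)).filter fun x => q x.rk).image (toL n) : Finset _) := by
    ext ⟨L, p, R⟩
    simp only [Finset.coe_image, Set.mem_image, Finset.mem_coe, Finset.mem_filter]
    constructor
    · rintro ⟨h1, h2, h3⟩
      obtain ⟨x, hx, e⟩ := toL_surj h1 h2
      refine ⟨x, ⟨hx, ?_⟩, e⟩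
      have := toL_rank n x
      rw [e] at this
      rw [← this]; exact h3
    · rintro ⟨x, ⟨hx, hq⟩, e⟩
      obtain ⟨hv, hs⟩ := mem_C.1 hx
      have a1 := toL_valid (n := n) hv
      have a2 := toL_sum (n := n) hs
      have a3 := toL_rank n x
      rw [e] at a1 a2 a3
      refine ⟨a1, a2, ?_⟩
      rw [a3]; exact hq
  have h2 : Nat.card {x : List ℕ × ℕ × List ℕ //
      IsOddBalanced x.1 x.2.1 x.2.2 ∧ x.1.sum + x.2.1 + x.2.2.sum = 2 * n + 2 ∧
      q ((x.2.2.length : ℤ) - (x.1.length : ℤ))} = Set.ncard {x : List ℕ × ℕ × List ℕ |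
      IsOddBalanced x.1 x.2.1 x.2.2 ∧ x.1.sum + x.2.1 + x.2.2.sum = 2 * n + 2 ∧
      q ((x.2.2.length : ℤ) - (x.1.length : ℤ))} := rfl
  rw [h2, himg, Set.ncard_coe_finset, Finset.card_image_of_injOn]
  intro x hx y hy e
  have hx := Finset.mem_filter.1 (Finset.mem_coe.1 hx)
  have hy := Finset.mem_filter.1 (Finset.mem_coe.1 hy)
  exact toL_inj (mem_C.1 hx.1).1 (mem_C.1 hy.1).1 e

lemma total_eq (n : ℕ) : oddBalancedTotal n = (C (n + 1)).card := by
  classical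
  have := card_lists n (fun _ => True)
  simp only [and_true, Finset.filter_true] at this
  exact this

lemma mod_eq (a : ℤ) (c n : ℕ) : oddBalancedCountMod a c n = (Cm a c (n + 1)).card := by
  classical
  have := card_lists n (fun r => r ≡ a [ZMOD (c : ℤ)])
  rw [oddBalancedCountMod, this, Cm]

end OBCore


/-- Equidistribution of ranks of odd-balanced unimodal sequences mod odd `c > 1`:
`v(a,c;n) ~ v(n)/c` as `n → ∞`. -/
theorem oddBalancedCountMod_equidistributed (a : ℤ) (c : ℕ) (hc : 1 < c) (hcodd : Odd c) :
    Tendsto (fun n : ℕ => (c : ℝ) * (oddBalancedCountMod a c n : ℝ) /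
      (oddBalancedTotal n : ℝ)) atTop (nhds 1) := by
  have h := (OBCore.main a c hc).comp (tendsto_add_atTop_nat 1)
  refine h.congr fun n => ?_
  simp only [Function.comp, OBCore.total_eq, OBCore.mod_eq]
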